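/- arXiv:2012.14684 — 3 statements merged into one kernel-verified Lean document; each statement's English description precedes it below -/
import Mathlib

section
/- There exist Hermitian 2×2 matrices B_N and B_D with the following property. For a Hermitian 2×2 matrix B let B~ denote its reflection along the anti-diagonal. For L ≥ 5 and ★ ∈ {N, D}, let T^{★,0}_{h,L} be T_{h,L} with B_★ added to its top-left 2×2 corner, T^{0,★}_{h,L} be T_{h,L} with B~_★ added to its bottom-right 2×2 corner, and T^{★,★}_{h,L} be T_{h,L} with both corner modifications. Then for all integers L1, L2 ≥ 5 and L = L1 + L2: (inf_{x∈ℝ} h(x))·Id ≤ T^{N,N}_{h,L1} ⊕ T^{N,N}_{h,L2} ≤ T^{0,N}_{h,L1} ⊕ T^{N,0}_{h,L2} ≤ T_{h,L} ≤ T^{0,D}_{h,L1} ⊕ T^{D,0}_{h,L2}, where for Hermitian matrices A ≤ B means B − A is positive semidefinite and A ⊕ B is the block-diagonal matrix with diagonal blocks A and B. -/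
open scoped ComplexConjugate ComplexOrder
open Matrix Finset

noncomputable section

/-- The five-diagonal `L × L` Toeplitz matrix of the symbol
`h(x) = a2 e^{-2ix} + a1 e^{-ix} + a0 + a1 e^{ix} + a2 e^{2ix}`:
entries `a_{|m-j|}` for `|m-j| ≤ 2` and `0` otherwise. -/
def Th (a0 a1 a2 : ℝ) (L : ℕ) : Matrix (Fin L) (Fin L) ℂ :=
  Matrix.of fun j m =>
    if ((m : ℤ) - (j : ℤ)).natAbs = 0 then (a0 : ℂ)
    else if ((m : ℤ) - (j : ℤ)).natAbs = 1 then (a1 : ℂ)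
    else if ((m : ℤ) - (j : ℤ)).natAbs = 2 then (a2 : ℂ)
    else 0

/-- The `L × L` matrix with the `N × N` matrix `B` placed in the top-left corner. -/
def cornerTL {N : ℕ} (L : ℕ) (B : Matrix (Fin N) (Fin N) ℂ) : Matrix (Fin L) (Fin L) ℂ :=
  Matrix.of fun j m => ∑ p : Fin N, ∑ q : Fin N,
    if (j : ℕ) = (p : ℕ) ∧ (m : ℕ) = (q : ℕ) then B p q else 0

/-- The `L × L` matrix with the `N × N` matrix `B` placed in the bottom-right corner. -/
def cornerBR {N : ℕ} (L : ℕ) (B : Matrix (Fin N) (Fin N) ℂ) : Matrix (Fin L) (Fin L) ℂ :=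
  Matrix.of fun j m => ∑ p : Fin N, ∑ q : Fin N,
    if (j : ℕ) = L - N + (p : ℕ) ∧ (m : ℕ) = L - N + (q : ℕ) then B p q else 0

/-- Reflection of an `N × N` matrix along the anti-diagonal. -/
def reflectAD {N : ℕ} (B : Matrix (Fin N) (Fin N) ℂ) : Matrix (Fin N) (Fin N) ℂ :=
  Matrix.of fun j m => B j.rev m.rev

/-- `T^{★,0}_{h,L}`: boundary matrix added to the top-left corner. -/
def Thstar0 (a0 a1 a2 : ℝ) (B : Matrix (Fin 2) (Fin 2) ℂ) (L : ℕ) :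
    Matrix (Fin L) (Fin L) ℂ :=
  Th a0 a1 a2 L + cornerTL L B

/-- `T^{0,★}_{h,L}`: reflected boundary matrix added to the bottom-right corner. -/
def Th0star (a0 a1 a2 : ℝ) (B : Matrix (Fin 2) (Fin 2) ℂ) (L : ℕ) :
    Matrix (Fin L) (Fin L) ℂ :=
  Th a0 a1 a2 L + cornerBR L (reflectAD B)

/-- `T^{★,★}_{h,L}`: both corner modifications. -/
def Thstarstar (a0 a1 a2 : ℝ) (B : Matrix (Fin 2) (Fin 2) ℂ) (L : ℕ) :
    Matrix (Fin L) (Fin L) ℂ :=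
  Th a0 a1 a2 L + cornerTL L B + cornerBR L (reflectAD B)

/-- Block-diagonal matrix `A ⊕ B`, viewed as an `(L1+L2) × (L1+L2)` matrix. -/
def bdiag {L1 L2 : ℕ} (X : Matrix (Fin L1) (Fin L1) ℂ) (Y : Matrix (Fin L2) (Fin L2) ℂ) :
    Matrix (Fin (L1 + L2)) (Fin (L1 + L2)) ℂ :=
  Matrix.reindex finSumFinEquiv finSumFinEquiv (Matrix.fromBlocks X 0 0 Y)

/-- A real matrix of the form `c ∑ₖ fₖ fₖᵀ` with `c ≥ 0` is positive semidefinite. -/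
lemma posSemidef_of_eq_sum_mul {ι κ : Type*} [Fintype ι] {M : Matrix ι ι ℂ} {c : ℝ} (hc : 0 ≤ c)
    (s : Finset κ) (f : κ → ι → ℝ) (h : ∀ i j, M i j = c * ∑ k ∈ s, (f k i : ℂ) * f k j) :
    M.PosSemidef := by
  have hM : M = (c : ℂ) • ∑ k ∈ s, vecMulVec (fun i => (f k i : ℂ)) (star fun i => (f k i : ℂ)) := by
    ext i j
    simp [h, Matrix.sum_apply, vecMulVec_apply]
  rw [hM]
  exact (posSemidef_sum s fun k _ => posSemidef_vecMulVec_self_star _).smul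
    (by exact_mod_cast hc)

lemma Matrix.PosSemidef.bdiag {L1 L2 : ℕ} {X : Matrix (Fin L1) (Fin L1) ℂ}
    {Y : Matrix (Fin L2) (Fin L2) ℂ} (hX : X.PosSemidef) (hY : Y.PosSemidef) :
    (bdiag X Y).PosSemidef := by
  have h : (fromBlocks X 0 0 Y).PosSemidef := by
    refine .of_dotProduct_mulVec_nonneg ?_ fun x => ?_
    · exact hX.1.fromBlocks (by simp) hY.1
    · have hx : x = Sum.elim (x ∘ Sum.inl) (x ∘ Sum.inr) := by simp
      rw [hx, fromBlocks_mulVec]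
      simpa [dotProduct, Fintype.sum_sum_type] using
        add_nonneg (hX.dotProduct_mulVec_nonneg (x ∘ Sum.inl))
          (hY.dotProduct_mulVec_nonneg (x ∘ Sum.inr))
  exact h.submatrix _

lemma bdiag_sub_bdiag {L1 L2 : ℕ} (X X' : Matrix (Fin L1) (Fin L1) ℂ)
    (Y Y' : Matrix (Fin L2) (Fin L2) ℂ) :
    bdiag X Y - bdiag X' Y' = bdiag (X - X') (Y - Y') := by
  ext i j
  refine Fin.addCases (fun i => ?_) (fun i => ?_) i <;>
  refine Fin.addCases (fun j => ?_) (fun j => ?_) j <;>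
  simp [bdiag]

lemma bdiag_smul_one {L1 L2 : ℕ} (c : ℂ) :
    bdiag (c • (1 : Matrix (Fin L1) (Fin L1) ℂ)) (c • (1 : Matrix (Fin L2) (Fin L2) ℂ)) =
      c • (1 : Matrix (Fin (L1 + L2)) (Fin (L1 + L2)) ℂ) := by
  have h : fromBlocks (c • (1 : Matrix (Fin L1) (Fin L1) ℂ)) 0 0
      (c • (1 : Matrix (Fin L2) (Fin L2) ℂ)) = c • 1 := by
    rw [← fromBlocks_one, fromBlocks_smul, smul_zero, smul_zero]
  rw [bdiag, h]
  ext i j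
  simp [one_apply]

/-- The coefficient at site `i` of the second-order difference `u ↦ uₖ + t uₖ₊₁ + uₖ₊₂`. -/
def diffCoeff (t : ℝ) (k i : ℕ) : ℝ :=
  (if i = k then 1 else 0) + t * (if i = k + 1 then 1 else 0) + (if i = k + 2 then 1 else 0)

/-- The matrix of the quadratic form `a (|u₀|² + |t u₀ + u₁|²)` on `ℂ²`. -/
def boundaryGram (a t : ℝ) : Matrix (Fin 2) (Fin 2) ℂ :=
  !![((a * (1 + t ^ 2) : ℝ) : ℂ), ((a * t : ℝ) : ℂ); ((a * t : ℝ) : ℂ), (a : ℂ)]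

lemma isHermitian_boundaryGram (a t : ℝ) : (boundaryGram a t).IsHermitian := by
  ext i j
  fin_cases i <;> fin_cases j <;> simp [boundaryGram]

lemma cornerTL_neg {N : ℕ} (L : ℕ) (B : Matrix (Fin N) (Fin N) ℂ) :
    cornerTL L (-B) = -cornerTL L B := by
  ext i j
  simp only [cornerTL, of_apply, Matrix.neg_apply, ← sum_neg_distrib, neg_ite, neg_zero]

lemma cornerBR_neg {N : ℕ} (L : ℕ) (B : Matrix (Fin N) (Fin N) ℂ) :
    cornerBR L (-B) = -cornerBR L B := by
  ext i j
  simp only [cornerBR, of_apply, Matrix.neg_apply, ← sum_neg_distrib, neg_ite, neg_zero]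

lemma reflectAD_neg {N : ℕ} (B : Matrix (Fin N) (Fin N) ℂ) : reflectAD (-B) = -reflectAD B := rfl

lemma cornerTL_boundaryGram_apply (a t : ℝ) {L : ℕ} (i j : Fin L) :
    cornerTL L (boundaryGram a t) i j = a * ((if (i : ℕ) = 0 then 1 else 0) *
      (if (j : ℕ) = 0 then 1 else 0) +
      (t * (if (i : ℕ) = 0 then 1 else 0) + (if (i : ℕ) = 1 then 1 else 0)) *
      (t * (if (j : ℕ) = 0 then 1 else 0) + (if (j : ℕ) = 1 then 1 else 0))) := by
  simp only [cornerTL, of_apply, Fin.sum_univ_two, boundaryGram, ite_and,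
    Fin.val_zero, Fin.val_one]
  split_ifs <;> simp <;> first | omega | (left; ring)

lemma cornerBR_boundaryGram_apply (a t : ℝ) {L : ℕ} (hL : 2 ≤ L) (i j : Fin L) :
    cornerBR L (reflectAD (boundaryGram a t)) i j =
      a * ((t * (if (i : ℕ) + 1 = L then 1 else 0) + (if (i : ℕ) + 2 = L then 1 else 0)) *
      (t * (if (j : ℕ) + 1 = L then 1 else 0) + (if (j : ℕ) + 2 = L then 1 else 0)) +
      (if (i : ℕ) + 1 = L then 1 else 0) * (if (j : ℕ) + 1 = L then 1 else 0)) := by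
  have e0 : ∀ k : ℕ, k = L - 2 ↔ k + 2 = L := by omega
  have e1 : ∀ k : ℕ, k = L - 2 + 1 ↔ k + 1 = L := by omega
  simp only [cornerBR, reflectAD, of_apply, Fin.sum_univ_two, boundaryGram, ite_and,
    Fin.val_zero, Fin.val_one, add_zero, e0, e1]
  split_ifs <;> simp <;> first | omega | (left; ring)

lemma posSemidef_cornerTL_boundaryGram {a : ℝ} (ha : 0 ≤ a) (t : ℝ) (L : ℕ) :
    (cornerTL L (boundaryGram a t)).PosSemidef := by
  refine posSemidef_of_eq_sum_mul ha univ
    ![fun i => if (i : ℕ) = 0 then 1 else 0,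
      fun i => t * (if (i : ℕ) = 0 then 1 else 0) + (if (i : ℕ) = 1 then 1 else 0)] fun i j => ?_
  rw [cornerTL_boundaryGram_apply]
  simp [Fin.sum_univ_two, apply_ite Complex.ofReal]

lemma posSemidef_cornerBR_boundaryGram {a : ℝ} (ha : 0 ≤ a) (t : ℝ) {L : ℕ} (hL : 2 ≤ L) :
    (cornerBR L (reflectAD (boundaryGram a t))).PosSemidef := by
  refine posSemidef_of_eq_sum_mul ha univ
    ![fun i => t * (if (i : ℕ) + 1 = L then 1 else 0) + (if (i : ℕ) + 2 = L then 1 else 0),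
      fun i => if (i : ℕ) + 1 = L then 1 else 0] fun i j => ?_
  rw [cornerBR_boundaryGram_apply _ _ hL]
  simp [Fin.sum_univ_two, apply_ite Complex.ofReal]

lemma sum_range_ite_mul_ite (n a b i j : ℕ) :
    ∑ k ∈ range n, (if i = k + a then (1 : ℂ) else 0) * (if j = k + b then 1 else 0) =
      if i + b = j + a ∧ a ≤ i ∧ i < n + a then 1 else 0 := by
  simp only [← ite_and, mul_ite, mul_one, mul_zero]
  split_ifs with h
  · rw [sum_eq_single (i - a)]
    · rw [if_pos (by omega)]
    · intro k _ hk
      rw [if_neg (by omega)]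
    · simp
      omega
  · refine sum_eq_zero fun k hk => ?_
    rw [mem_range] at hk
    rw [if_neg (by omega)]

/-- The Neumann matrix, shifted by the minimum of the symbol, is the Gram matrix of the
second-order differences `uₖ + t uₖ₊₁ + uₖ₊₂` supported inside `{0, …, L - 1}`. -/
lemma Thstarstar_neg_boundaryGram_sub_apply (a0 a2 t : ℝ) {L : ℕ} (hL : 4 ≤ L) (i j : Fin L) :
    (Thstarstar a0 (2 * t * a2) a2 (-boundaryGram a2 t) L -
      ((a0 - 2 * a2 - t ^ 2 * a2 : ℝ) : ℂ) • (1 : Matrix (Fin L) (Fin L) ℂ)) i j =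
      a2 * ∑ k ∈ range (L - 2), (diffCoeff t k i : ℂ) * diffCoeff t k j := by
  have hsum : ∑ k ∈ range (L - 2), (diffCoeff t k i : ℂ) * diffCoeff t k j =
      ∑ p : Fin 3, ∑ q : Fin 3, (![1, (t : ℂ), 1] p * ![1, (t : ℂ), 1] q) *
        if (i : ℕ) + q = j + p ∧ (p : ℕ) ≤ i ∧ (i : ℕ) < L - 2 + p then 1 else 0 := by
    simp only [← sum_range_ite_mul_ite, mul_sum]
    simp only [Fin.sum_univ_three, ← sum_add_distrib]
    refine sum_congr rfl fun k _ => ?_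
    simp only [diffCoeff, Complex.ofReal_add, Complex.ofReal_mul, apply_ite Complex.ofReal,
      Complex.ofReal_one, Complex.ofReal_zero, Fin.val_zero, Fin.val_one, Fin.val_two, add_zero,
      Matrix.cons_val]
    ring
  rw [hsum]
  simp only [Thstarstar, cornerTL_neg, reflectAD_neg, cornerBR_neg, Matrix.sub_apply,
    Matrix.add_apply, Matrix.neg_apply, Matrix.smul_apply, cornerTL_boundaryGram_apply,
    cornerBR_boundaryGram_apply _ _ (show 2 ≤ L by omega), one_apply, Th, of_apply,
    Fin.sum_univ_three, Fin.ext_iff, smul_eq_mul]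
  obtain ⟨i, hi⟩ := i
  obtain ⟨j, hj⟩ := j
  simp only [Fin.val_zero, Fin.val_one, Fin.val_two, Matrix.cons_val]
  push_cast
  have hd : (j = i ∨ j = i + 1 ∨ j = i + 2 ∨ i = j + 1 ∨ i = j + 2 ∨ i + 2 < j ∨ j + 2 < i) := by
    omega
  have hb : i = 0 ∨ i = 1 ∨ i + 1 = L ∨ i + 2 = L ∨ (2 ≤ i ∧ i + 2 < L) := by omega
  rcases hd with hd | hd | hd | hd | hd | hd | hd <;>
  rcases hb with hb | hb | hb | hb | hb <;>
  first | omega | (simp (disch := omega) only [if_pos, if_neg]; ring)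

/-- Coupling two chains with either sign is dominated by the boundary Gram matrices. -/
lemma posSemidef_coupling (a0 : ℝ) {a2 : ℝ} (ha : 0 ≤ a2) (t : ℝ) {s : ℝ} (hs : s * s = 1)
    {L1 L2 : ℕ} (hL1 : 2 ≤ L1) :
    ((s : ℂ) • (Th a0 (2 * t * a2) a2 (L1 + L2) -
        bdiag (Th a0 (2 * t * a2) a2 L1) (Th a0 (2 * t * a2) a2 L2)) +
      bdiag (cornerBR L1 (reflectAD (boundaryGram a2 t)))
        (cornerTL L2 (boundaryGram a2 t))).PosSemidef := by
  have hs' : (s : ℂ) * s = 1 := by exact_mod_cast hs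
  refine posSemidef_of_eq_sum_mul ha univ
    ![Fin.addCases
        (fun i : Fin L1 => t * (if (i : ℕ) + 1 = L1 then 1 else 0) +
          (if (i : ℕ) + 2 = L1 then 1 else 0))
        (fun j : Fin L2 => s * (if (j : ℕ) = 0 then 1 else 0)),
      Fin.addCases
        (fun i : Fin L1 => if (i : ℕ) + 1 = L1 then 1 else 0)
        (fun j : Fin L2 => s * (t * (if (j : ℕ) = 0 then 1 else 0) +
          (if (j : ℕ) = 1 then 1 else 0)))] fun i j => ?_
  simp only [Fin.sum_univ_two, Matrix.cons_val, bdiag, Matrix.add_apply, Matrix.smul_apply,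
    Matrix.sub_apply, reindex_apply, submatrix_apply, smul_eq_mul]
  refine Fin.addCases (fun i => ?_) (fun i => ?_) i <;>
  refine Fin.addCases (fun j => ?_) (fun j => ?_) j <;>
  simp only [Fin.addCases_left, Fin.addCases_right, finSumFinEquiv_symm_apply_castAdd,
    finSumFinEquiv_symm_apply_natAdd, fromBlocks_apply₁₁, fromBlocks_apply₁₂, fromBlocks_apply₂₁,
    fromBlocks_apply₂₂, cornerTL_boundaryGram_apply, Matrix.zero_apply,
    cornerBR_boundaryGram_apply _ _ hL1, Complex.ofReal_add,
    Complex.ofReal_mul, apply_ite Complex.ofReal, Complex.ofReal_one, Complex.ofReal_zero]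
  · simp [Th]
  · obtain ⟨i, hi⟩ := i
    obtain ⟨j, hj⟩ := j
    simp only [Th, of_apply, Fin.val_castAdd, Fin.val_natAdd]
    push_cast
    have hi' : i + 1 = L1 ∨ i + 2 = L1 ∨ i + 2 < L1 := by omega
    have hj' : j = 0 ∨ j = 1 ∨ 2 ≤ j := by omega
    rcases hi' with hi' | hi' | hi' <;> rcases hj' with hj' | hj' | hj' <;>
    simp (disch := omega) only [if_pos, if_neg] <;> ring
  · obtain ⟨i, hi⟩ := i
    obtain ⟨j, hj⟩ := j
    simp only [Th, of_apply, Fin.val_castAdd, Fin.val_natAdd]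
    push_cast
    have hi' : i = 0 ∨ i = 1 ∨ 2 ≤ i := by omega
    have hj' : j + 1 = L1 ∨ j + 2 = L1 ∨ j + 2 < L1 := by omega
    rcases hi' with hi' | hi' | hi' <;> rcases hj' with hj' | hj' | hj' <;>
    simp (disch := omega) only [if_pos, if_neg] <;> ring
  · simp only [Th, of_apply, Fin.val_natAdd, Nat.cast_add, add_sub_add_left_eq_sub, sub_self,
      mul_zero, zero_add]
    linear_combination (-a2 * ((if (i : ℕ) = 0 then 1 else 0) * (if (j : ℕ) = 0 then 1 else 0) +
      (t * (if (i : ℕ) = 0 then 1 else 0) + (if (i : ℕ) = 1 then 1 else 0)) *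
      (t * (if (j : ℕ) = 0 then 1 else 0) + (if (j : ℕ) = 1 then 1 else 0))) : ℂ) * hs'

/-- For the five-diagonal symbol `h(x) = a0 + 2 a1 cos x + 2 a2 cos 2x`
with `a2 > 0` and `-4 ≤ a1/a2 ≤ 4`, there exist Hermitian `2 × 2` boundary matrices
`B_N`, `B_D` such that for all `L1, L2 ≥ 5`, `L = L1 + L2`:
`(inf h)·Id ≤ T^{N,N}_{h,L1} ⊕ T^{N,N}_{h,L2} ≤ T^{0,N}_{h,L1} ⊕ T^{N,0}_{h,L2}
≤ T_{h,L} ≤ T^{0,D}_{h,L1} ⊕ T^{D,0}_{h,L2}` in the Loewner order. -/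
theorem exists_dirichlet_neumann_boundary_conditions_pentadiagonal
    (a0 a1 a2 : ℝ) (ha2 : 0 < a2) (h1 : -4 ≤ a1 / a2) (h2 : a1 / a2 ≤ 4) :
    ∃ BN BD : Matrix (Fin 2) (Fin 2) ℂ, BN.IsHermitian ∧ BD.IsHermitian ∧
      ∀ L1 L2 : ℕ, 5 ≤ L1 → 5 ≤ L2 →
        (bdiag (Thstarstar a0 a1 a2 BN L1) (Thstarstar a0 a1 a2 BN L2)
          - ((↑(⨅ x : ℝ, (a0 + 2 * a1 * Real.cos x + 2 * a2 * Real.cos (2 * x))) : ℂ)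
              • (1 : Matrix (Fin (L1 + L2)) (Fin (L1 + L2)) ℂ))).PosSemidef ∧
        (bdiag (Th0star a0 a1 a2 BN L1) (Thstar0 a0 a1 a2 BN L2)
          - bdiag (Thstarstar a0 a1 a2 BN L1) (Thstarstar a0 a1 a2 BN L2)).PosSemidef ∧
        (Th a0 a1 a2 (L1 + L2)
          - bdiag (Th0star a0 a1 a2 BN L1) (Thstar0 a0 a1 a2 BN L2)).PosSemidef ∧
        (bdiag (Th0star a0 a1 a2 BD L1) (Thstar0 a0 a1 a2 BD L2)
          - Th a0 a1 a2 (L1 + L2)).PosSemidef := by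
  obtain ⟨t, rfl⟩ : ∃ t, a1 = 2 * t * a2 := ⟨a1 / a2 / 2, by field_simp⟩
  rw [mul_div_cancel_right₀ _ ha2.ne'] at h1 h2
  have hinf : (⨅ x : ℝ, (a0 + 2 * (2 * t * a2) * Real.cos x + 2 * a2 * Real.cos (2 * x))) ≤
      a0 - 2 * a2 - t ^ 2 * a2 := by
    refine (ciInf_le ⟨a0 - 2 * a2 - t ^ 2 * a2, ?_⟩ (Real.arccos (-t / 2))).trans_eq ?_
    · rintro _ ⟨x, rfl⟩
      simp only [Real.cos_two_mul]
      nlinarith [mul_nonneg ha2.le (sq_nonneg (2 * Real.cos x + t))]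
    · rw [Real.cos_two_mul, Real.cos_arccos (by linarith) (by linarith)]
      ring
  have hNN : ∀ L, 5 ≤ L → (Thstarstar a0 (2 * t * a2) a2 (-boundaryGram a2 t) L -
      ((⨅ x : ℝ, (a0 + 2 * (2 * t * a2) * Real.cos x + 2 * a2 * Real.cos (2 * x)) : ℝ) : ℂ) •
        (1 : Matrix (Fin L) (Fin L) ℂ)).PosSemidef := by
    intro L hL
    set m := ⨅ x : ℝ, (a0 + 2 * (2 * t * a2) * Real.cos x + 2 * a2 * Real.cos (2 * x))
    have h := (posSemidef_of_eq_sum_mul ha2.le (range (L - 2))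
      (fun k (i : Fin L) => diffCoeff t k i)
      (Thstarstar_neg_boundaryGram_sub_apply a0 a2 t (by omega))).add
      ((PosSemidef.one (n := Fin L) (R := ℂ)).smul
        (show (0 : ℂ) ≤ ((a0 - 2 * a2 - t ^ 2 * a2 - m : ℝ) : ℂ) by
          exact_mod_cast sub_nonneg.2 hinf))
    convert h using 1
    push_cast
    module
  refine ⟨-boundaryGram a2 t, boundaryGram a2 t, (isHermitian_boundaryGram a2 t).neg,
    isHermitian_boundaryGram a2 t, fun L1 L2 hL1 hL2 => ⟨?_, ?_, ?_, ?_⟩⟩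
  · rw [← bdiag_smul_one, bdiag_sub_bdiag]
    exact (hNN L1 hL1).bdiag (hNN L2 hL2)
  · rw [bdiag_sub_bdiag]
    convert (posSemidef_cornerTL_boundaryGram ha2.le t L1).bdiag
      (posSemidef_cornerBR_boundaryGram ha2.le t (show 2 ≤ L2 by omega)) using 2
    · simp only [Th0star, Thstarstar, cornerTL_neg]
      abel
    · simp only [Thstar0, Thstarstar, reflectAD_neg, cornerBR_neg]
      abel
  · convert posSemidef_coupling a0 ha2.le t (s := 1) (L1 := L1) (L2 := L2) (by norm_num)
      (by omega) using 1
    simp only [Th0star, Thstar0, cornerTL_neg, reflectAD_neg, cornerBR_neg, ← sub_eq_add_neg,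
      ← bdiag_sub_bdiag, Complex.ofReal_one, one_smul]
    abel
  · convert posSemidef_coupling a0 ha2.le t (s := -1) (L1 := L1) (L2 := L2) (by norm_num)
      (by omega) using 1
    have h : ∀ X : Matrix (Fin L1) (Fin L1) ℂ, ∀ Y : Matrix (Fin L2) (Fin L2) ℂ,
        bdiag (Th a0 (2 * t * a2) a2 L1 + X) (Th a0 (2 * t * a2) a2 L2 + Y) =
          bdiag (Th a0 (2 * t * a2) a2 L1) (Th a0 (2 * t * a2) a2 L2) + bdiag X Y := fun X Y => by
      rw [← sub_eq_iff_eq_add', bdiag_sub_bdiag, add_sub_cancel_left, add_sub_cancel_left]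
    rw [Th0star, Thstar0, h]
    push_cast
    module
end
end

section
/- Let n ≥ 1 and let E_1, …, E_n ∈ ℝ be pairwise distinct modulo 2π. Then for every integer L ≥ 1 there exists Ẽ ∈ ℝ such that for all k ∈ {1, …, L} and all i ∈ {1, …, n}: ‖(2πk)/L − Ẽ − E_i‖_{2π} ≥ (2π/2^n)·(1/L). -/
/-- Finitely many translates can be moved simultaneously to distance at least `1 / 2 ^ n`
from the integers. -/
theorem exists_shift_away_from_integers {n : ℕ} (hn : 1 ≤ n) :
    ∀ a : Fin n → ℝ, ∃ t : ℝ, ∀ (i : Fin n) (m : ℤ), 1 / 2 ^ n ≤ |t + a i - m| := by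
  induction n, hn using Nat.le_induction with
  | base =>
    intro a
    refine ⟨1 / 2 - a 0, fun i m => ?_⟩
    rw [Subsingleton.elim i 0, sub_add_cancel, le_abs]
    rcases le_or_gt m 0 with h | h
    · have : (m : ℝ) ≤ 0 := mod_cast h
      left; linarith
    · have : (1 : ℝ) ≤ m := mod_cast h
      right; linarith
  | succ n hn ih =>
    intro a
    obtain ⟨t, ht⟩ := ih fun i => a i.succ
    obtain ⟨δ, hδ⟩ : ∃ δ : ℝ, δ = 1 / 2 ^ (n + 1) := ⟨_, rfl⟩
    have hδ0 : 0 < δ := by rw [hδ]; positivity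
    have h2 : (1 : ℝ) / 2 ^ n = 2 * δ := by rw [hδ, pow_succ]; field_simp
    have h4 : 4 * δ ≤ 1 := by
      have : (1 : ℝ) / 2 ^ n ≤ 1 / 2 ^ 1 := by gcongr; norm_num
      linarith
    rw [h2] at ht
    rw [← hδ]
    by_cases h : ∀ m : ℤ, δ ≤ |t + δ + a 0 - m|
    · refine ⟨t + δ, Fin.forall_fin_succ.2 ⟨h, fun i m => ?_⟩⟩
      have := ht i m
      rw [le_abs] at this ⊢
      rcases this with h | h
      · left; linarith
      · right; linarith
    · push Not at h
      obtain ⟨m₀, h₀⟩ := h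
      refine ⟨t - δ, Fin.forall_fin_succ.2 ⟨fun m => ?_, fun i m => ?_⟩⟩
      · by_contra! h₁
        rw [abs_lt] at h₀ h₁
        have hpos : (m : ℝ) < m₀ := by linarith
        have hlt : (m₀ : ℝ) < m + 1 := by linarith
        norm_cast at hpos hlt
        lia
      · have := ht i m
        rw [le_abs] at this ⊢
        rcases this with h | h
        · left; linarith
        · right; linarith

/-- Given `E_1, …, E_n` pairwise distinct modulo `2π`, for every `L ≥ 1`
there exists `Ẽ ∈ ℝ` such that every grid point `2πk/L - Ẽ` (`k = 1,…,L`) keeps circle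
distance at least `(2π/2^n)·(1/L)` from each `E_i`. Here the circle distance of `x` to `0`
is the norm on `AddCircle (2π)`. -/
theorem grid_shift_away_from_minima
    {n : ℕ} (hn : 1 ≤ n) (E : Fin n → ℝ)
    (hE : Function.Injective fun i => Complex.exp (Complex.I * (E i))) :
    ∀ L : ℕ, 1 ≤ L → ∃ Etil : ℝ, ∀ k : ℕ, 1 ≤ k → k ≤ L → ∀ i : Fin n,
      2 * Real.pi / 2 ^ n * (1 / L) ≤
        ‖((2 * Real.pi * k / L - Etil - E i : ℝ) : AddCircle (2 * Real.pi))‖ := by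
  intro L hL
  have hL0 : (0 : ℝ) < L := mod_cast hL
  have hπ := Real.pi_pos
  obtain ⟨t, ht⟩ := exists_shift_away_from_integers hn fun i => -(L * E i / (2 * Real.pi))
  refine ⟨-(2 * Real.pi * t / L), fun k _ _ i => ?_⟩
  rw [AddCircle.norm_eq]
  generalize round (_ : ℝ) = r
  have h := ht i (r * L - k)
  have hx : 2 * Real.pi * k / L - -(2 * Real.pi * t / L) - E i - r * (2 * Real.pi) =
      2 * Real.pi / L * (t + -(L * E i / (2 * Real.pi)) - ((r * L - k : ℤ) : ℝ)) := by
    push_cast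
    field_simp
    ring
  rw [hx, abs_mul, abs_of_pos (by positivity : 0 < 2 * Real.pi / L)]
  calc 2 * Real.pi / 2 ^ n * (1 / L) = 2 * Real.pi / L * (1 / 2 ^ n) := by ring
    _ ≤ _ := by gcongr
end

section
/- For all integers L1, L2 ≥ 5 and L = L1 + L2, the matrix T_{g,L} − (T^{0,N}_{g,L1} ⊕ T^{N,0}_{g,L2}) is neither positive semidefinite nor negative semidefinite; in particular, for the square of the discrete Laplacian, the standard (Hankel) Neumann boundary condition does not satisfy the Dirichlet–Neumann bracketing inequality T^{0,N}_{g,L1} ⊕ T^{N,0}_{g,L2} ≤ T_{g,L}. -/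
open Matrix

noncomputable section

/-- The `L × L` Toeplitz matrix of `g(x) = (2 - 2cos x)²` (the square of the negative
discrete Laplacian): `a_0 = 6`, `a_{±1} = -4`, `a_{±2} = 1`, `a_r = 0` for `|r| ≥ 3`. -/
def TLap2 (L : ℕ) : Matrix (Fin L) (Fin L) ℝ :=
  Matrix.of fun j m =>
    if ((m : ℤ) - (j : ℤ)).natAbs = 0 then 6
    else if ((m : ℤ) - (j : ℤ)).natAbs = 1 then -4
    else if ((m : ℤ) - (j : ℤ)).natAbs = 2 then 1
    else 0

/-- The standard Neumann corner modification at the left end: `H_{1,1} = -4`,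
`H_{1,2} = H_{2,1} = 1`, all other entries `0`. -/
def HNeu (L : ℕ) : Matrix (Fin L) (Fin L) ℝ :=
  Matrix.of fun j m =>
    if (j : ℕ) = 0 ∧ (m : ℕ) = 0 then -4
    else if ((j : ℕ) = 0 ∧ (m : ℕ) = 1) ∨ ((j : ℕ) = 1 ∧ (m : ℕ) = 0) then 1
    else 0

/-- The standard Neumann corner modification at the right end: `H~_{L,L} = -4`,
`H~_{L-1,L} = H~_{L,L-1} = 1`, all other entries `0`. -/
def HNeuR (L : ℕ) : Matrix (Fin L) (Fin L) ℝ :=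
  Matrix.of fun j m =>
    if (j : ℕ) = L - 1 ∧ (m : ℕ) = L - 1 then -4
    else if ((j : ℕ) = L - 2 ∧ (m : ℕ) = L - 1) ∨ ((j : ℕ) = L - 1 ∧ (m : ℕ) = L - 2) then 1
    else 0

/-- Block-diagonal matrix `A ⊕ B`, viewed as an `(L1+L2) × (L1+L2)` matrix. -/
def bdiagR {L1 L2 : ℕ} (X : Matrix (Fin L1) (Fin L1) ℝ) (Y : Matrix (Fin L2) (Fin L2) ℝ) :
    Matrix (Fin (L1 + L2)) (Fin (L1 + L2)) ℝ :=
  Matrix.reindex finSumFinEquiv finSumFinEquiv (Matrix.fromBlocks X 0 0 Y)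

theorem bdiagR_castAdd_castAdd {L1 L2 : ℕ} (X : Matrix (Fin L1) (Fin L1) ℝ)
    (Y : Matrix (Fin L2) (Fin L2) ℝ) (i j : Fin L1) :
    bdiagR X Y (Fin.castAdd L2 i) (Fin.castAdd L2 j) = X i j := by
  simp [bdiagR]

/-- On indices of the first block the bracketing difference is minus the corner modification. -/
theorem bracketing_sub_castAdd_castAdd {L1 L2 : ℕ} (i j : Fin L1) :
    (TLap2 (L1 + L2) - bdiagR (TLap2 L1 + HNeuR L1) (TLap2 L2 + HNeu L2))
      (Fin.castAdd L2 i) (Fin.castAdd L2 j) = -HNeuR L1 i j := by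
  rw [Matrix.sub_apply, bdiagR_castAdd_castAdd, Matrix.add_apply]
  simp [TLap2]

/-- A real matrix with a vanishing diagonal entry and a positive product of the corresponding
symmetric off-diagonal entries is not positive semidefinite. -/
theorem not_posSemidef_of_diag_eq_zero {n : Type*} {M : Matrix n n ℝ} {i j : n}
    (hii : M i i = 0) (hij : 0 < M i j * M j i) : ¬ M.PosSemidef := by
  intro h
  have hdet := (h.submatrix ![i, j]).det_nonneg
  rw [Matrix.det_fin_two] at hdet
  simp only [Matrix.submatrix_apply, Matrix.cons_val_zero, Matrix.cons_val_one, hii] at hdet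
  linarith

/-- For the square of the discrete Laplacian, the standard (Hankel)
Neumann boundary conditions fail Dirichlet-Neumann bracketing: for all `L1, L2 ≥ 5`,
`T_{g,L1+L2} - (T^{0,N}_{g,L1} ⊕ T^{N,0}_{g,L2})` is neither positive semidefinite nor
negative semidefinite; in particular `T^{0,N}_{g,L1} ⊕ T^{N,0}_{g,L2} ≤ T_{g,L}` fails. -/
theorem standard_neumann_bracketing_fails
    (L1 L2 : ℕ) (hL1 : 5 ≤ L1) (hL2 : 5 ≤ L2) :
    ¬ (TLap2 (L1 + L2) - bdiagR (TLap2 L1 + HNeuR L1) (TLap2 L2 + HNeu L2)).PosSemidef ∧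
    ¬ (-(TLap2 (L1 + L2) - bdiagR (TLap2 L1 + HNeuR L1) (TLap2 L2 + HNeu L2))).PosSemidef := by
  have h₁ : HNeuR L1 ⟨L1 - 2, by omega⟩ ⟨L1 - 2, by omega⟩ = 0 := by
    simp only [HNeuR, Matrix.of_apply]
    rw [if_neg (by omega), if_neg (by omega)]
  have h₂ : HNeuR L1 ⟨L1 - 2, by omega⟩ ⟨L1 - 1, by omega⟩ = 1 := by
    simp only [HNeuR, Matrix.of_apply]
    rw [if_neg (by omega), if_pos (by simp)]
  have h₃ : HNeuR L1 ⟨L1 - 1, by omega⟩ ⟨L1 - 2, by omega⟩ = 1 := by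
    simp only [HNeuR, Matrix.of_apply]
    rw [if_neg (by omega), if_pos (by simp)]
  constructor <;>
  refine not_posSemidef_of_diag_eq_zero (i := Fin.castAdd L2 ⟨L1 - 2, by omega⟩)
    (j := Fin.castAdd L2 ⟨L1 - 1, by omega⟩) ?_ ?_ <;>
  simp only [Matrix.neg_apply, bracketing_sub_castAdd_castAdd, h₁, h₂, h₃] <;> norm_num
end
end
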